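/- If φ : (0,∞) → ℝ is a Bernstein function, then the function s ↦ φ(s)/s is completely monotone on (0,∞). -/

import Mathlib

open Set

def CompletelyMonotoneOn (f : ℝ → ℝ) : Prop :=
  ContDiffOn ℝ (⊤ : ℕ∞) f (Ioi 0) ∧
  ∀ n : ℕ, ∀ t ∈ Ioi (0:ℝ), 0 ≤ (-1)^n * iteratedDerivWithin n f (Ioi 0) t

def BernsteinFn (φ : ℝ → ℝ) : Prop :=
  ContDiffOn ℝ (⊤ : ℕ∞) φ (Ioi 0) ∧
  (∀ t ∈ Ioi (0:ℝ), 0 ≤ φ t) ∧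
  CompletelyMonotoneOn (derivWithin φ (Ioi 0))

/-- Leibniz rule for the product `s * (f s / s)` on the positive half-line. -/
theorem mul_iteratedDerivWithin_div_id_succ {f : ℝ → ℝ}
    (hf : ContDiffOn ℝ (⊤ : ℕ∞) f (Ioi 0)) (n : ℕ) {s : ℝ} (hs : s ∈ Ioi (0 : ℝ)) :
    s * iteratedDerivWithin (n + 1) (fun x => f x / x) (Ioi 0) s +
      (n + 1) * iteratedDerivWithin n (fun x => f x / x) (Ioi 0) s =
      iteratedDerivWithin (n + 1) f (Ioi 0) s := by
  have hu : UniqueDiffOn ℝ (Ioi (0 : ℝ)) := uniqueDiffOn_Ioi 0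
  have hg : ContDiffOn ℝ (⊤ : ℕ∞) (fun x => f x / x) (Ioi 0) :=
    hf.div contDiffOn_id fun x hx => (mem_Ioi.mp hx).ne'
  have hderiv (k : ℕ) {x : ℝ} (hx : x ∈ Ioi (0 : ℝ)) :
      HasDerivWithinAt (iteratedDerivWithin k (fun x => f x / x) (Ioi 0))
        (iteratedDerivWithin (k + 1) (fun x => f x / x) (Ioi 0) x) (Ioi 0) x := by
    rw [iteratedDerivWithin_succ]
    exact (hg.differentiableOn_iteratedDerivWithin
      (mod_cast ENat.natCast_lt_top k) hu x hx).hasDerivWithinAt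
  induction n generalizing s with
  | zero =>
    have h := ((hasDerivWithinAt_id s (Ioi 0)).mul (hderiv 0 hs)).derivWithin (hu s hs)
    rw [zero_add, iteratedDerivWithin_one (f := f),
      derivWithin_congr (f := id * iteratedDerivWithin 0 (fun x => f x / x) (Ioi 0))
        (f₁ := f) ?_ ?_, h]
    · simp; ring
    · intro x hx
      have := (mem_Ioi.mp hx).ne'
      simp; field_simp
    · have := (mem_Ioi.mp hs).ne'
      simp; field_simp
  | succ n ih =>
    have h := (((hasDerivWithinAt_id s (Ioi 0)).mul (hderiv (n + 1) hs)).add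
      ((hderiv n hs).const_mul ((n : ℝ) + 1))).derivWithin (hu s hs)
    rw [iteratedDerivWithin_succ (f := f),
      ← derivWithin_congr (fun x hx => ih hx) (ih hs)]
    refine Eq.trans ?_ h.symm
    simp only [id, Nat.cast_add, Nat.cast_one]
    ring

/-- The derivatives of `f s / s` are, up to an explicit factor, the values at `0` of the Taylor
polynomials of `f` at `s`. -/
theorem pow_mul_iteratedDerivWithin_div_id {f : ℝ → ℝ}
    (hf : ContDiffOn ℝ (⊤ : ℕ∞) f (Ioi 0)) (n : ℕ) {s : ℝ} (hs : s ∈ Ioi (0 : ℝ)) :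
    s ^ (n + 1) * ((-1) ^ n * iteratedDerivWithin n (fun x => f x / x) (Ioi 0) s) =
      n.factorial * taylorWithinEval f n (Ioi 0) s 0 := by
  induction n with
  | zero =>
    have := (mem_Ioi.mp hs).ne'
    simp; field_simp
  | succ n ih =>
    have hn : (n.factorial : ℝ) ≠ 0 := mod_cast n.factorial_ne_zero
    have hn' : (n : ℝ) + 1 ≠ 0 := by positivity
    have hT : ((n + 1).factorial : ℝ) * taylorWithinEval f (n + 1) (Ioi 0) s 0 =
        (n + 1) * (n.factorial * taylorWithinEval f n (Ioi 0) s 0) +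
          (-s) ^ (n + 1) * iteratedDerivWithin (n + 1) f (Ioi 0) s := by
      rw [taylorWithinEval_succ, Nat.factorial_succ, smul_eq_mul, zero_sub]
      push_cast
      field_simp
    rw [hT, ← ih, ← mul_iteratedDerivWithin_div_id_succ hf n hs, neg_pow s]
    ring

theorem BernsteinFn.taylorWithinEval_nonneg {φ : ℝ → ℝ} (hφ : BernsteinFn φ) (n : ℕ) {x s : ℝ}
    (hx : 0 < x) (hxs : x ≤ s) : 0 ≤ taylorWithinEval φ n (Ioi 0) s x := by
  obtain ⟨hsmooth, hnonneg, -, hcm⟩ := hφ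
  have hu : UniqueDiffOn ℝ (Ioi (0 : ℝ)) := uniqueDiffOn_Ioi 0
  have hderiv : ∀ y ∈ Ioi (0 : ℝ), HasDerivWithinAt (fun t => taylorWithinEval φ n (Ioi 0) t x)
      (((n.factorial : ℝ)⁻¹ * (x - y) ^ n) • iteratedDerivWithin (n + 1) φ (Ioi 0) y)
      (Ioi 0) y := fun y hy =>
    hasDerivWithinAt_taylorWithinEval hu self_mem_nhdsWithin hy subset_rfl
      (hsmooth.of_le (mod_cast le_top))
      (hsmooth.differentiableOn_iteratedDerivWithin (mod_cast ENat.natCast_lt_top n) hu y hy)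
  have hsub : Ici x ⊆ Ioi 0 := fun y hy => hx.trans_le hy
  have hmono : MonotoneOn (fun t => taylorWithinEval φ n (Ioi 0) t x) (Ici x) := by
    refine monotoneOn_of_hasDerivWithinAt_nonneg (convex_Ici x)
      (fun y hy => ((hderiv y (hsub hy)).mono hsub).continuousWithinAt)
      (fun y hy => (hderiv y (hsub (interior_subset hy))).mono (interior_subset.trans hsub))
      fun y hy => ?_
    have hxy : x ≤ y := interior_subset hy
    have h := hcm n y (hsub hxy)
    rw [← iteratedDerivWithin_succ'] at h
    have hfac : ((n.factorial : ℝ)⁻¹ * (x - y) ^ n) • iteratedDerivWithin (n + 1) φ (Ioi 0) y =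
        (n.factorial : ℝ)⁻¹ * (y - x) ^ n *
          ((-1) ^ n * iteratedDerivWithin (n + 1) φ (Ioi 0) y) := by
      rw [← neg_sub y x, neg_pow, smul_eq_mul]
      ring
    rw [hfac]
    have := sub_nonneg.mpr hxy
    positivity
  calc 0 ≤ φ x := hnonneg x hx
    _ = taylorWithinEval φ n (Ioi 0) x x := (taylorWithinEval_self ..).symm
    _ ≤ taylorWithinEval φ n (Ioi 0) s x := hmono self_mem_Ici hxs hxs

theorem BernsteinFn.taylorWithinEval_zero_nonneg {φ : ℝ → ℝ} (hφ : BernsteinFn φ) (n : ℕ) {s : ℝ}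
    (hs : 0 < s) : 0 ≤ taylorWithinEval φ n (Ioi 0) s 0 := by
  have hcont : Continuous fun x => taylorWithinEval φ n (Ioi 0) s x := by
    simp_rw [taylor_within_apply]
    fun_prop
  refine ge_of_tendsto (hcont.continuousWithinAt (s := Ioi 0) (x := 0)) ?_
  filter_upwards [Ioc_mem_nhdsGT hs] with x hx
  exact hφ.taylorWithinEval_nonneg n hx.1 hx.2

theorem bernstein_div_id_cm (φ : ℝ → ℝ) (hφ : BernsteinFn φ) :
    CompletelyMonotoneOn (fun s => φ s / s) := by
  refine ⟨hφ.1.div contDiffOn_id fun x hx => (mem_Ioi.mp hx).ne', fun n t ht => ?_⟩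
  have h : 0 ≤ t ^ (n + 1) *
      ((-1) ^ n * iteratedDerivWithin n (fun s => φ s / s) (Ioi 0) t) := by
    rw [pow_mul_iteratedDerivWithin_div_id hφ.1 n ht]
    exact mul_nonneg (Nat.cast_nonneg _) (hφ.taylorWithinEval_zero_nonneg n ht)
  exact nonneg_of_mul_nonneg_right h (pow_pos ht _)
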